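/- Let P_1, P_{−1} be probability distributions on {−1,1}^d. Then for every a ∈ {−1,1}^{2d}, the total variation distance satisfies d_TV(D_{a,0}, D_{a,1}) ≤ 2 d_TV(P_1, −P_{−1}), where −P_{−1} denotes the pushforward of P_{−1} under x ↦ −x. -/

import Mathlib

open MeasureTheory

/-- The Boolean cube `{-1,1}^d` inside `Fin d → ℝ`. -/
def cube (d : ℕ) : Set (Fin d → ℝ) := {x | ∀ i, x i = 1 ∨ x i = -1}

/-- The Fourier coefficient `D̂(S) = E_{x∼D}[∏_{i∈S} x_i]` of a distribution on `{-1,1}^d`. -/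
noncomputable def cubeFourier {d : ℕ} (D : Measure (Fin d → ℝ)) (S : Finset (Fin d)) : ℝ :=
  ∫ x, ∏ i ∈ S, x i ∂D

/-- `sign(t) = 1` if `t ≥ 0` and `-1` otherwise. -/
noncomputable def sgn (t : ℝ) : ℝ := if 0 ≤ t then 1 else -1

/-- An element of `{-1,1}^{2d}`, viewed as a pair of blocks of `d` coordinates. -/
abbrev Pair (d : ℕ) := (Fin d → ℝ) × (Fin d → ℝ)

/-- The uniform distribution on `{-1,1} ⊆ ℝ`. -/
noncomputable def unifSign : Measure ℝ :=
  (2 : ENNReal)⁻¹ • Measure.dirac (1 : ℝ) + (2 : ENNReal)⁻¹ • Measure.dirac (-1 : ℝ)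

/-- The distribution of `(y z, y z')` where `y` is uniform in `{-1,1}`, `z ∼ ν` and
`z' ∼ ν'`, all independent. -/
noncomputable def Dzero {d : ℕ} (ν ν' : Measure (Fin d → ℝ)) : Measure (Pair d) :=
  Measure.map
    (fun q : ℝ × ((Fin d → ℝ) × (Fin d → ℝ)) =>
      ((fun i => q.1 * q.2.1 i), (fun i => q.1 * q.2.2 i)))
    (unifSign.prod (ν.prod ν'))

/-- `D_0` (for `b = false`) and `D_1` (for `b = true`), built from `P₁` and `P₋₁`. -/
noncomputable def Db {d : ℕ} (P1 Pm1 : Measure (Fin d → ℝ)) (b : Bool) : Measure (Pair d) :=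
  if b then Dzero Pm1 P1 else Dzero P1 Pm1

/-- The distribution `D_{a,b}`, obtained by drawing `x' ∼ D_b` and setting `x_i = a_i x'_i`. -/
noncomputable def Dab {d : ℕ} (P1 Pm1 : Measure (Fin d → ℝ)) (a : Pair d) (b : Bool) :
    Measure (Pair d) :=
  Measure.map (fun x : Pair d => ((fun i => a.1 i * x.1 i), (fun i => a.2 i * x.2 i)))
    (Db P1 Pm1 b)

/-- The total variation distance between two probability measures. -/
noncomputable def tvDist {X : Type*} [MeasurableSpace X] (P Q : Measure X) : ℝ :=
  ⨆ s : {s : Set X // MeasurableSet s}, |(P s).toReal - (Q s).toReal|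

section TotalVariation

variable {X Y : Type*} [MeasurableSpace X] [MeasurableSpace Y]

theorem abs_real_sub_le_tvDist (P Q : Measure X) [IsProbabilityMeasure P]
    [IsProbabilityMeasure Q] {s : Set X} (hs : MeasurableSet s) :
    |P.real s - Q.real s| ≤ tvDist P Q := by
  refine le_ciSup (f := fun s : {s : Set X // MeasurableSet s} =>
    |(P s).toReal - (Q s).toReal|) ⟨1, ?_⟩ ⟨s, hs⟩
  rintro _ ⟨t, rfl⟩
  have hP : P.real t ≤ 1 := measureReal_le_one
  have hQ : Q.real t ≤ 1 := measureReal_le_one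
  have hP0 : 0 ≤ P.real t := measureReal_nonneg
  have hQ0 : 0 ≤ Q.real t := measureReal_nonneg
  change |P.real t - Q.real t| ≤ 1
  rw [abs_le]
  constructor <;> linarith

theorem tvDist_le {P Q : Measure X} {c : ℝ}
    (h : ∀ s, MeasurableSet s → |P.real s - Q.real s| ≤ c) : tvDist P Q ≤ c := by
  have : Nonempty {s : Set X // MeasurableSet s} := ⟨⟨∅, MeasurableSet.empty⟩⟩
  exact ciSup_le fun s => h s s.2

theorem tvDist_comm (P Q : Measure X) : tvDist P Q = tvDist Q P := by
  simp only [tvDist, abs_sub_comm]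

theorem tvDist_map_le (P Q : Measure X) [IsProbabilityMeasure P] [IsProbabilityMeasure Q]
    {f : X → Y} (hf : Measurable f) : tvDist (P.map f) (Q.map f) ≤ tvDist P Q := by
  refine tvDist_le fun s hs => ?_
  rw [map_measureReal_apply hf hs, map_measureReal_apply hf hs]
  exact abs_real_sub_le_tvDist P Q (hf hs)

theorem abs_integral_sub_le {R : Measure X} [IsProbabilityMeasure R] {f g : X → ℝ} {c : ℝ}
    (hf : Integrable f R) (hg : Integrable g R) (h : ∀ x, |f x - g x| ≤ c) :
    |(∫ x, f x ∂ R) - (∫ x, g x ∂ R)| ≤ c := by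
  rw [← integral_sub hf hg, ← Real.norm_eq_abs]
  simpa using norm_integral_le_of_norm_le_const (μ := R) (f := fun x => f x - g x)
    (Filter.Eventually.of_forall h)

theorem integrable_measureReal_prodMk_left (P : Measure X) (R : Measure Y)
    [IsProbabilityMeasure P] [IsProbabilityMeasure R] {s : Set (X × Y)} (hs : MeasurableSet s) :
    Integrable (fun x => R.real (Prod.mk x ⁻¹' s)) P :=
  Measure.integrable_measure_prodMk_left hs (measure_ne_top _ _)

theorem prod_measureReal_apply (P : Measure X) (R : Measure Y)
    [IsProbabilityMeasure P] [IsProbabilityMeasure R] {s : Set (X × Y)} (hs : MeasurableSet s) :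
    (P.prod R).real s = ∫ x, R.real (Prod.mk x ⁻¹' s) ∂P := by
  rw [measureReal_def, Measure.prod_apply hs]
  exact (integral_toReal (measurable_measure_prodMk_left hs).aemeasurable
    (Filter.Eventually.of_forall fun _ => measure_lt_top _ _)).symm

theorem tvDist_prod_left_le (R : Measure X) (P Q : Measure Y) [IsProbabilityMeasure P]
    [IsProbabilityMeasure Q] [IsProbabilityMeasure R] :
    tvDist (R.prod P) (R.prod Q) ≤ tvDist P Q := by
  refine tvDist_le fun s hs => ?_
  rw [prod_measureReal_apply R P hs, prod_measureReal_apply R Q hs]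
  exact abs_integral_sub_le (integrable_measureReal_prodMk_left R P hs)
    (integrable_measureReal_prodMk_left R Q hs)
    fun x => abs_real_sub_le_tvDist P Q (measurable_prodMk_left hs)

theorem tvDist_prod_right_le (P Q : Measure X) (R : Measure Y) [IsProbabilityMeasure P]
    [IsProbabilityMeasure Q] [IsProbabilityMeasure R] :
    tvDist (P.prod R) (Q.prod R) ≤ tvDist P Q := by
  rw [← Measure.prod_swap (μ := R) (ν := P), ← Measure.prod_swap (μ := R) (ν := Q)]
  exact (tvDist_map_le _ _ measurable_swap).trans (tvDist_prod_left_le R P Q)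

theorem abs_prod_sub_prod_neg_le [InvolutiveNeg X] [MeasurableNeg X] (P M : Measure X)
    [IsProbabilityMeasure P] [IsProbabilityMeasure M] {s : Set (X × X)} (hs : MeasurableSet s) :
    |(P.prod M).real s - (M.prod P).real (Prod.map Neg.neg Neg.neg ⁻¹' s)| ≤
      2 * tvDist P (M.map Neg.neg) := by
  have hn : Measurable (Neg.neg : X → X) := measurable_neg
  have : IsProbabilityMeasure (M.map Neg.neg) := Measure.isProbabilityMeasure_map hn.aemeasurable
  have : IsProbabilityMeasure (P.map Neg.neg) := Measure.isProbabilityMeasure_map hn.aemeasurable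
  rw [← map_measureReal_apply (hn.prodMap hn) hs, ← Measure.map_prod_map _ _ hn hn]
  have h1 := (abs_real_sub_le_tvDist (P.prod M) ((M.map Neg.neg).prod M) hs).trans
    (tvDist_prod_right_le P (M.map Neg.neg) M)
  have h2 := (abs_real_sub_le_tvDist ((M.map Neg.neg).prod M)
    ((M.map Neg.neg).prod (P.map Neg.neg)) hs).trans (tvDist_prod_left_le _ M (P.map Neg.neg))
  have h3 := tvDist_map_le (M.map Neg.neg) P hn
  rw [Measure.map_map hn hn, neg_involutive.comp_self, Measure.map_id,
    tvDist_comm (M.map _) P] at h3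
  have h4 := abs_sub_le ((P.prod M).real s) (((M.map Neg.neg).prod M).real s)
    (((M.map Neg.neg).prod (P.map Neg.neg)).real s)
  linarith

end TotalVariation

instance isProbabilityMeasure_unifSign : IsProbabilityMeasure unifSign :=
  ⟨by simp [unifSign, ENNReal.inv_two_add_inv_two]⟩

theorem measurable_signScale (d : ℕ) :
    Measurable (fun q : ℝ × ((Fin d → ℝ) × (Fin d → ℝ)) =>
      (((fun i => q.1 * q.2.1 i), (fun i => q.1 * q.2.2 i)) : Pair d)) := by
  fun_prop

instance isProbabilityMeasure_Dzero {d : ℕ} (P M : Measure (Fin d → ℝ))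
    [IsProbabilityMeasure P] [IsProbabilityMeasure M] : IsProbabilityMeasure (Dzero P M) :=
  Measure.isProbabilityMeasure_map (measurable_signScale d).aemeasurable

theorem Dzero_real_apply {d : ℕ} (P M : Measure (Fin d → ℝ)) [IsProbabilityMeasure P]
    [IsProbabilityMeasure M] {s : Set (Pair d)} (hs : MeasurableSet s) :
    (Dzero P M).real s = ((P.prod M).real s +
      (P.prod M).real (Prod.map Neg.neg Neg.neg ⁻¹' s)) / 2 := by
  have hm := measurable_signScale d
  rw [Dzero, map_measureReal_apply hm hs, measureReal_def, Measure.prod_apply (hm hs), unifSign,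
    lintegral_add_measure, lintegral_smul_measure, lintegral_smul_measure, lintegral_dirac,
    lintegral_dirac]
  have h1 : Prod.mk (1 : ℝ) ⁻¹' ((fun q : ℝ × ((Fin d → ℝ) × (Fin d → ℝ)) =>
      (((fun i => q.1 * q.2.1 i), (fun i => q.1 * q.2.2 i)) : Pair d)) ⁻¹' s) = s := by
    ext x; simp
  have h2 : Prod.mk (-1 : ℝ) ⁻¹' ((fun q : ℝ × ((Fin d → ℝ) × (Fin d → ℝ)) =>
      (((fun i => q.1 * q.2.1 i), (fun i => q.1 * q.2.2 i)) : Pair d)) ⁻¹' s) =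
      Prod.map Neg.neg Neg.neg ⁻¹' s := by
    ext x
    simp only [Set.mem_preimage, neg_one_mul]
    rfl
  rw [h1, h2, smul_eq_mul, smul_eq_mul, ← mul_add, ENNReal.toReal_mul,
    ENNReal.toReal_add (measure_ne_top _ _) (measure_ne_top _ _)]
  simp only [measureReal_def, ENNReal.toReal_inv, ENNReal.toReal_ofNat]
  ring

theorem tvDist_Dzero_swap_le {d : ℕ} (P M : Measure (Fin d → ℝ)) [IsProbabilityMeasure P]
    [IsProbabilityMeasure M] :
    tvDist (Dzero P M) (Dzero M P) ≤ 2 * tvDist P (M.map Neg.neg) := by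
  refine tvDist_le fun s hs => ?_
  have hn : Measurable (Neg.neg : (Fin d → ℝ) → (Fin d → ℝ)) := measurable_neg
  have h1 := abs_prod_sub_prod_neg_le P M hs
  have h2 := abs_prod_sub_prod_neg_le P M ((hn.prodMap hn) hs)
  rw [← Set.preimage_comp, Prod.map_comp_map, neg_involutive.comp_self, Prod.map_id,
    Set.preimage_id] at h2
  rw [Dzero_real_apply P M hs, Dzero_real_apply M P hs]
  rw [abs_le] at *
  constructor <;> linarith [h1.1, h1.2, h2.1, h2.2]

/-- For probability distributions `P₁, P₋₁` on `{-1,1}^d` and every `a ∈ {-1,1}^{2d}`,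
`d_TV(D_{a,0}, D_{a,1}) ≤ 2 d_TV(P₁, -P₋₁)`, where `-P₋₁` is the pushforward of `P₋₁`
under `x ↦ -x`. -/
theorem tv_of_Dab (d : ℕ) (P1 Pm1 : Measure (Fin d → ℝ))
    [IsProbabilityMeasure P1] [IsProbabilityMeasure Pm1]
    (hP1 : P1 (cube d) = 1) (hPm1 : Pm1 (cube d) = 1)
    (a : Pair d) (ha1 : a.1 ∈ cube d) (ha2 : a.2 ∈ cube d) :
    tvDist (Dab P1 Pm1 a false) (Dab P1 Pm1 a true) ≤
      2 * tvDist P1 (Measure.map (fun x i => -x i) Pm1) := by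
  have hm : Measurable (fun x : Pair d =>
      (((fun i => a.1 i * x.1 i), (fun i => a.2 i * x.2 i)) : Pair d)) := by
    fun_prop
  exact (tvDist_map_le (Dzero P1 Pm1) (Dzero Pm1 P1) hm).trans (tvDist_Dzero_swap_le P1 Pm1)
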